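/- arXiv:1303.6556 — 4 statements merged into one kernel-verified Lean document; each statement's English description precedes it below -/
import Mathlib

section
/- Let H : 𝕋 → ℂ be measurable and satisfy the Smith–Barnwell condition |H(z)|² + |H(−z)|² = 1 for a.e. z ∈ 𝕋. Define operators on L²(𝕋) by (P_V F)(z) = H(z)(conj(H(z))·F(z) + conj(H(−z))·F(−z)) and (P_W F)(z) = conj(H(−z))·(H(−z)·F(z) − H(z)·F(−z)). Then P_V and P_W are orthogonal (self-adjoint, idempotent) projections on L²(𝕋), P_V P_W = P_W P_V = 0, and P_V + P_W = I. -/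
open Complex MeasureTheory
open scoped ComplexConjugate

/-- The normalized Haar (arclength) measure of the unit circle `𝕋 ⊆ ℂ`, realized as a
measure on `ℂ`: the pushforward of Lebesgue measure on `[0,1)` under `t ↦ e^{2πit}`. -/
noncomputable def circleMeasure : Measure ℂ :=
  (volume.restrict (Set.Ico (0 : ℝ) 1)).map fun t : ℝ =>
    Complex.exp (2 * Real.pi * Complex.I * t)

/-- The circle measure is invariant under the reflection `z ↦ -z`. -/
theorem measurePreserving_neg_circleMeasure :
    MeasurePreserving (fun z : ℂ => -z) circleMeasure circleMeasure := by
  have hmk : MeasurePreserving ((↑) : ℝ → AddCircle (1 : ℝ))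
      (volume.restrict (Set.Ico (0 : ℝ) 1)) volume := by
    have h := AddCircle.measurePreserving_mk (1 : ℝ) 0
    rwa [zero_add, ← restrict_Ico_eq_restrict_Ioc] at h
  have hg : Measurable fun x : AddCircle (1 : ℝ) => (x.toCircle : ℂ) :=
    (continuous_subtype_val.comp AddCircle.continuous_toCircle).measurable
  have hcoe : (fun t : ℝ => Complex.exp (2 * Real.pi * Complex.I * t)) =
      (fun x : AddCircle (1 : ℝ) => (x.toCircle : ℂ)) ∘ ((↑) : ℝ → AddCircle (1 : ℝ)) := by
    funext t
    simp only [Function.comp_apply, AddCircle.toCircle_apply_mk, Circle.coe_exp]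
    congr 1
    push_cast
    ring
  have hmap : circleMeasure =
      (volume : Measure (AddCircle (1 : ℝ))).map fun x => (x.toCircle : ℂ) := by
    rw [circleMeasure, hcoe, ← Measure.map_map hg hmk.measurable, hmk.map_eq]
  have hhalf : (AddCircle.toCircle ((1 / 2 : ℝ) : AddCircle (1 : ℝ)) : ℂ) = -1 := by
    rw [AddCircle.toCircle_apply_mk, Circle.coe_exp, ← Complex.exp_pi_mul_I]
    congr 1
    push_cast
    ring
  have hneg : (fun z : ℂ => -z) ∘ (fun x : AddCircle (1 : ℝ) => (x.toCircle : ℂ)) =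
      (fun x : AddCircle (1 : ℝ) => (x.toCircle : ℂ)) ∘
        fun x => x + ((1 / 2 : ℝ) : AddCircle (1 : ℝ)) := by
    funext x
    simp only [Function.comp_apply, AddCircle.toCircle_add, Circle.coe_mul, hhalf]
    ring
  refine ⟨measurable_neg, ?_⟩
  have hadd := measurePreserving_add_right (volume : Measure (AddCircle (1 : ℝ)))
    ((1 / 2 : ℝ) : AddCircle (1 : ℝ))
  rw [hmap, Measure.map_map measurable_neg hg, hneg, ← Measure.map_map hg hadd.measurable,
    hadd.map_eq]

/-- An odd function has integral zero for a reflection-invariant measure. -/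
theorem integral_eq_zero_of_odd_of_measurePreserving_neg {μ : Measure ℂ}
    (hμ : MeasurePreserving (fun z : ℂ => -z) μ μ) {d : ℂ → ℂ} (hd : ∀ z, d (-z) = -d z) :
    ∫ z, d z ∂μ = 0 := by
  have h := hμ.integral_comp (MeasurableEquiv.neg ℂ).measurableEmbedding d
  simp only [hd, integral_neg] at h
  exact self_eq_neg.mp h.symm

/-- Let `H : 𝕋 → ℂ` be measurable, satisfying the Smith–Barnwell condition
`|H(z)|² + |H(−z)|² = 1` a.e. on `𝕋`.  If `P_V` and `P_W` are the bounded operators on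
`L²(𝕋)` given a.e. by `(P_V F)(z) = H(z)(conj(H(z))F(z) + conj(H(−z))F(−z))` and
`(P_W F)(z) = conj(H(−z))(H(−z)F(z) − H(z)F(−z))`, then `P_V, P_W` are orthogonal
(self-adjoint, idempotent) projections, `P_V P_W = P_W P_V = 0`, and `P_V + P_W = I`. -/
theorem subband_projections
    (H : ℂ → ℂ) (hHmeas : Measurable H)
    (hSB : ∀ᵐ z ∂circleMeasure, ‖H z‖ ^ 2 + ‖H (-z)‖ ^ 2 = 1)
    (PV PW : Lp ℂ 2 circleMeasure →L[ℂ] Lp ℂ 2 circleMeasure)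
    (hPV : ∀ F : Lp ℂ 2 circleMeasure,
      (PV F : ℂ → ℂ) =ᵐ[circleMeasure]
        fun z => H z * (conj (H z) * F z + conj (H (-z)) * F (-z)))
    (hPW : ∀ F : Lp ℂ 2 circleMeasure,
      (PW F : ℂ → ℂ) =ᵐ[circleMeasure]
        fun z => conj (H (-z)) * (H (-z) * F z - H z * F (-z))) :
    IsSelfAdjoint PV ∧ IsIdempotentElem PV ∧
    IsSelfAdjoint PW ∧ IsIdempotentElem PW ∧
    PV * PW = 0 ∧ PW * PV = 0 ∧ PV + PW = 1 := by
  have hneg := measurePreserving_neg_circleMeasure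
  have hsum : PV + PW = 1 := by
    ext1 F
    apply Lp.ext
    rw [add_apply, one_apply_eq_self]
    filter_upwards [Lp.coeFn_add (PV F) (PW F), hPV F, hPW F, hSB] with z hadd hV hW hz
    have hz' : H z * conj (H z) + H (-z) * conj (H (-z)) = 1 := by
      rw [mul_conj', mul_conj']
      exact_mod_cast hz
    rw [hadd, Pi.add_apply, hV, hW]
    linear_combination F z * hz'
  have hidem : PV * PV = PV := by
    ext1 F
    apply Lp.ext
    rw [mul_apply_eq_comp]
    filter_upwards [hPV (PV F), hPV F, hneg.quasiMeasurePreserving.ae (hPV F), hSB]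
      with z hVV hV hVneg hz
    have hz' : H z * conj (H z) + H (-z) * conj (H (-z)) = 1 := by
      rw [mul_conj', mul_conj']
      exact_mod_cast hz
    rw [neg_neg] at hVneg
    rw [hVV, hVneg, hV]
    linear_combination H z * (conj (H z) * F z + conj (H (-z)) * F (-z)) * hz'
  have hsa : IsSelfAdjoint PV := by
    rw [ContinuousLinearMap.isSelfAdjoint_iff_isSymmetric]
    intro F G
    rw [ContinuousLinearMap.coe_coe, ← sub_eq_zero, L2.inner_def, L2.inner_def,
      ← integral_sub (L2.integrable_inner _ _) (L2.integrable_inner _ _)]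
    let d : ℂ → ℂ := fun z =>
      conj (H z) * H (-z) * conj (F (-z)) * G z - conj (H (-z)) * H z * conj (F z) * G (-z)
    have hd : ∫ z, d z ∂circleMeasure = 0 :=
      integral_eq_zero_of_odd_of_measurePreserving_neg hneg fun z => by
        simp only [d, neg_neg]
        ring
    rw [← hd]
    apply integral_congr_ae
    filter_upwards [hPV F, hPV G] with z hF hG
    simp only [d, RCLike.inner_apply, hF, hG, map_mul, map_add, conj_conj]
    ring
  obtain rfl : PW = 1 - PV := eq_sub_of_add_eq' hsum
  have hidem' : IsIdempotentElem PV := hidem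
  exact ⟨hsa, hidem', (IsSelfAdjoint.one _).sub hsa, hidem'.one_sub, hidem'.mul_one_sub_self,
    hidem'.one_sub_mul_self, hsum⟩
end

section
/- Let M ≥ 2 be an integer, ω = e^{−2πi/M}, and let H₀, …, H_{M−1} : 𝕋 → ℂ be measurable functions such that the M×M matrix (H_n(ω^ℓ z))_{n,ℓ=0}^{M−1} is unitary for almost every z ∈ 𝕋. On L²(𝕋) define the unitary R_M by (R_M F)(z) = F(ωz), and for ℓ = 0, …, M−1 define P_ℓ F = H_ℓ · (∑_{j=0}^{M−1} R_M^j)(conj(H_ℓ) · F). Then each P_ℓ is an orthogonal projection on L²(𝕋), and the projections are mutually orthogonal: P_ℓ P_k = δ_{ℓ,k} P_ℓ for all 0 ≤ ℓ, k ≤ M−1. -/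
open Complex MeasureTheory
open scoped ComplexConjugate

theorem circleMeasure_eq_map_toCircle :
    circleMeasure = (volume : Measure (AddCircle (1 : ℝ))).map fun x => (x.toCircle : ℂ) := by
  have h := (AddCircle.measurePreserving_mk (1 : ℝ) 0).map_eq
  rw [← h, Measure.map_map (by fun_prop) (by fun_prop), circleMeasure, zero_add,
    Measure.restrict_congr_set Ico_ae_eq_Ioc]
  congr 1
  ext t
  simp only [Function.comp_apply, AddCircle.toCircle_apply_mk, Circle.coe_exp]
  congr 1
  push_cast
  ring

/-- The normalized arclength measure is invariant under rotations. -/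
theorem measurePreserving_mul_circleMeasure (c : Circle) :
    MeasurePreserving (fun z : ℂ => (c : ℂ) * z) circleMeasure circleMeasure := by
  obtain ⟨a, rfl⟩ := (AddCircle.homeomorphCircle (T := (1 : ℝ)) one_ne_zero).surjective c
  refine ⟨by fun_prop, ?_⟩
  have h := (measurePreserving_add_left (volume : Measure (AddCircle (1 : ℝ))) a).map_eq
  rw [circleMeasure_eq_map_toCircle, Measure.map_map (by fun_prop) (by fun_prop)]
  conv_rhs => rw [← h, Measure.map_map (by fun_prop) (by fun_prop)]
  congr 1
  ext x
  simp [AddCircle.toCircle_add, AddCircle.homeomorphCircle_apply]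

/-- A sum over the orbit of multiplication by a root of unity does not depend on the base point. -/
theorem sum_pow_mul_orbit {M : ℕ} {ω : ℂ} (hω : ω ^ M = 1) (g : ℂ → ℂ) (k : ℕ) (z : ℂ) :
    ∑ j : Fin M, g (ω ^ (j : ℕ) * (ω ^ k * z)) = ∑ j : Fin M, g (ω ^ (j : ℕ) * z) := by
  simp only [Fin.sum_univ_eq_sum_range fun j => g (ω ^ j * (ω ^ k * z)),
    Fin.sum_univ_eq_sum_range fun j => g (ω ^ j * z)]
  induction k with
  | zero => simp
  | succ k ih =>
    rw [← ih]
    have h := (Finset.sum_range_succ (fun j => g (ω ^ j * (ω ^ k * z))) M).symm.trans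
      (Finset.sum_range_succ' (fun j => g (ω ^ j * (ω ^ k * z))) M)
    simp only [hω, pow_zero] at h
    rw [add_right_cancel h]
    refine Finset.sum_congr rfl fun j _ => congrArg g ?_
    ring

/-- Integrals of functions with equal orbit sums coincide. -/
theorem integral_eq_of_orbit_sum_eq {M : ℕ} (hM : M ≠ 0) (c : Fin M → Circle) {f g : ℂ → ℂ}
    (hf : Integrable f circleMeasure) (hg : Integrable g circleMeasure)
    (h : ∀ᵐ z ∂circleMeasure, ∑ j, f (c j * z) = ∑ j, g (c j * z)) :
    ∫ z, f z ∂circleMeasure = ∫ z, g z ∂circleMeasure := by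
  have key : ∀ {u : ℂ → ℂ}, Integrable u circleMeasure →
      ∫ z, ∑ j, u (c j * z) ∂circleMeasure = M * ∫ z, u z ∂circleMeasure := by
    intro u hu
    have hi (j : Fin M) : Integrable (fun z => u (c j * z)) circleMeasure :=
      (measurePreserving_mul_circleMeasure (c j)).integrable_comp_of_integrable hu
    rw [integral_finsetSum _ fun j _ => hi j]
    have hj (j : Fin M) : ∫ z, u (c j * z) ∂circleMeasure = ∫ z, u z ∂circleMeasure :=
      (measurePreserving_mul_circleMeasure (c j)).integral_comp
        (measurableEmbedding_mulLeft₀ (c j).coe_ne_zero) u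
    simp [hj]
  have hfg := integral_congr_ae h
  rw [key hf, key hg] at hfg
  exact mul_left_cancel₀ (Nat.cast_ne_zero.mpr hM) hfg

/-- **M-band projections.** Let `M ≥ 2`, `ω = e^{−2πi/M}`, and let
`H₀,…,H_{M−1} : 𝕋 → ℂ` be measurable with `(H_n(ω^ℓ z))_{n,ℓ}` unitary for a.e. `z ∈ 𝕋`.
If `P_ℓ` are the bounded operators on `L²(𝕋)` given a.e. by
`(P_ℓ F)(z) = H_ℓ(z) ∑_{j<M} conj(H_ℓ(ω^j z)) F(ω^j z)`, then each `P_ℓ` is an orthogonal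
projection, and `P_ℓ P_k = δ_{ℓ,k} P_ℓ`. -/
theorem mband_projections
    (M : ℕ) (hM : 2 ≤ M)
    (ω : ℂ) (hω : ω = Complex.exp (-(2 * Real.pi * Complex.I) / M))
    (H : Fin M → ℂ → ℂ) (hmeas : ∀ n, Measurable (H n))
    (hunitary : ∀ᵐ z ∂circleMeasure,
      (Matrix.of fun n ℓ : Fin M => H n (ω ^ (ℓ : ℕ) * z)) ∈ Matrix.unitaryGroup (Fin M) ℂ)
    (P : Fin M → (Lp ℂ 2 circleMeasure →L[ℂ] Lp ℂ 2 circleMeasure))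
    (hP : ∀ (ℓ : Fin M) (F : Lp ℂ 2 circleMeasure),
      (P ℓ F : ℂ → ℂ) =ᵐ[circleMeasure]
        fun z => H ℓ z * ∑ j : Fin M, conj (H ℓ (ω ^ (j : ℕ) * z)) * F (ω ^ (j : ℕ) * z)) :
    ∀ ℓ k : Fin M, IsSelfAdjoint (P ℓ) ∧ IsIdempotentElem (P ℓ) ∧
      P ℓ * P k = if ℓ = k then P ℓ else 0 := by
  have hM0 : M ≠ 0 := by omega
  have hωM : ω ^ M = 1 := by
    rw [hω, ← Complex.exp_nat_mul, mul_div_cancel₀ _ (Nat.cast_ne_zero.mpr hM0), Complex.exp_neg,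
      Complex.exp_two_pi_mul_I, inv_one]
  have hωn : ‖ω‖ = 1 := Complex.norm_eq_one_of_pow_eq_one hωM hM0
  let c : Fin M → Circle := fun j => ⟨ω ^ (j : ℕ), by simp [Submonoid.unitSphere, hωn]⟩
  have hrot {p : ℂ → Prop} (h : ∀ᵐ z ∂circleMeasure, p z) :
      ∀ᵐ z ∂circleMeasure, ∀ j : Fin M, p (ω ^ (j : ℕ) * z) :=
    ae_all_iff.mpr fun j =>
      (measurePreserving_mul_circleMeasure (c j)).quasiMeasurePreserving.ae h
  have hinv (ℓ : Fin M) (F : ℂ → ℂ) (k : ℕ) (z : ℂ) :=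
    sum_pow_mul_orbit hωM (fun z => conj (H ℓ z) * F z) k z
  have hmul (ℓ k : Fin M) : P ℓ * P k = if ℓ = k then P ℓ else 0 := by
    ext1 F
    have hcomp : (P ℓ (P k F) : ℂ → ℂ) =ᵐ[circleMeasure] fun z => if ℓ = k then P ℓ F z else 0 := by
      filter_upwards [hP ℓ (P k F), hP ℓ F, hrot (hP k F), hunitary] with z h₁ h₂ h₃ hU
      have hortho : ∑ j : Fin M, H k (ω ^ (j : ℕ) * z) * conj (H ℓ (ω ^ (j : ℕ) * z)) =
          if k = ℓ then 1 else 0 := by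
        have h := congrFun (congrFun (Matrix.mem_unitaryGroup_iff.mp hU) k) ℓ
        simpa [Matrix.mul_apply, Matrix.star_apply, Matrix.one_apply] using h
      rw [h₁, h₂]
      simp only [h₃, hinv]
      simp only [← mul_assoc, ← Finset.sum_mul, mul_comm (conj _) (H k _), hortho]
      obtain rfl | h := eq_or_ne ℓ k
      · simp
      · simp [h, h.symm]
    refine Lp.ext (hcomp.trans ?_)
    split_ifs with h
    · simp
    · exact (Lp.coeFn_zero ℂ 2 circleMeasure).symm
  have hself (ℓ : Fin M) : IsSelfAdjoint (P ℓ) := by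
    rw [ContinuousLinearMap.isSelfAdjoint_iff_isSymmetric]
    intro F G
    simp only [ContinuousLinearMap.coe_coe, L2.inner_def]
    refine integral_eq_of_orbit_sum_eq hM0 c (L2.integrable_inner _ _) (L2.integrable_inner _ _) ?_
    filter_upwards [hrot (hP ℓ F), hrot (hP ℓ G)] with z hF hG
    simp only [c, RCLike.inner_apply, hF, hG, hinv, map_mul]
    set A := ∑ j : Fin M, conj (H ℓ (ω ^ (j : ℕ) * z)) * F (ω ^ (j : ℕ) * z) with hA
    set B := ∑ j : Fin M, conj (H ℓ (ω ^ (j : ℕ) * z)) * G (ω ^ (j : ℕ) * z) with hB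
    trans conj A * B
    · rw [hB, Finset.mul_sum]
      exact Finset.sum_congr rfl fun j _ => by ring
    · rw [hA, map_sum, Finset.sum_mul]
      exact Finset.sum_congr rfl fun j _ => by simp only [map_mul, conj_conj]; ring
  intro ℓ k
  exact ⟨hself ℓ, (hmul ℓ ℓ).trans (if_pos rfl), hmul ℓ k⟩
end

section
/- For ξ = (ξ₁,ξ₂) ∈ ℝ² with ξ₁ ≠ 0, let γ₁(ξ) = ½·sgn(ξ₁)·ξ₁² and γ₂(ξ) = ξ₂/ξ₁. For β = (β₁,β₂) ∈ ℝ², define the unitary chirp modulation X_β on L²(ℝ²) by (X_β F)(ξ) = e^{2πiβ₁γ₁(ξ)} e^{2πiβ₂γ₂(ξ)} F(ξ), and for s ∈ ℝ define the unitary shear S_s by (S_s F)(ξ₁,ξ₂) = F(ξ₁, ξ₂ − sξ₁). Then the Weyl–Heisenberg commutation relation S_s X_β = e^{−2πiβ₂ s} X_β S_s holds for all s ∈ ℝ and β ∈ ℝ². -/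
open Complex

/-- `γ₁(ξ) = ½ sgn(ξ₁) ξ₁²`. -/
noncomputable def gamma1 (ξ : ℝ × ℝ) : ℝ := (1 / 2) * Real.sign ξ.1 * ξ.1 ^ 2

/-- `γ₂(ξ) = ξ₂/ξ₁`. -/
noncomputable def gamma2 (ξ : ℝ × ℝ) : ℝ := ξ.2 / ξ.1

/-- The chirp modulation `X_β` acting on functions on the frequency plane. -/
noncomputable def chirpMod (β : ℝ × ℝ) (F : ℝ × ℝ → ℂ) : ℝ × ℝ → ℂ := fun ξ =>
  Complex.exp (2 * Real.pi * Complex.I * β.1 * gamma1 ξ) *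
    Complex.exp (2 * Real.pi * Complex.I * β.2 * gamma2 ξ) * F ξ

/-- The shear operator `S_s` acting on functions on the frequency plane. -/
noncomputable def shearOp (s : ℝ) (F : ℝ × ℝ → ℂ) : ℝ × ℝ → ℂ := fun ξ => F (ξ.1, ξ.2 - s * ξ.1)

/-- **Weyl–Heisenberg commutation relation.**
For all `s ∈ ℝ` and `β ∈ ℝ²`, `S_s X_β = e^{−2πiβ₂s} X_β S_s`
(as operators on `L²(ℝ²)`; the identity holds pointwise off the null set `{ξ₁ = 0}`). -/
theorem weyl_heisenberg_commutation (s : ℝ) (β : ℝ × ℝ) (F : ℝ × ℝ → ℂ)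
    (ξ : ℝ × ℝ) (hξ : ξ.1 ≠ 0) :
    shearOp s (chirpMod β F) ξ =
      Complex.exp (-(2 * Real.pi * Complex.I) * β.2 * s) * chirpMod β (shearOp s F) ξ := by
  have h_gamma : gamma2 (ξ.1, ξ.2 - s * ξ.1) = gamma2 ξ - s := by
    simp only [gamma2]
    field_simp
  have h_exp : Complex.exp (2 * Real.pi * Complex.I * β.2 * (gamma2 ξ - s : ℝ)) =
      Complex.exp (-(2 * Real.pi * Complex.I) * β.2 * s) *
        Complex.exp (2 * Real.pi * Complex.I * β.2 * gamma2 ξ) := by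
    rw [← Complex.exp_add]
    push_cast
    ring_nf
  simp only [shearOp, chirpMod, h_gamma, h_exp]
  simp only [gamma1]
  ring
end

section
/- Let K = {ξ ∈ ℝ² : |ξ₁| ≤ 1 and |ξ₂/ξ₁| ≤ 1/2}. For k ∈ ℤ and m = (m₁,m₂) ∈ ℤ², define Φ̂_{0,k,m}(ξ) = χ_K(ξ₁, ξ₂ − kξ₁) · e^{2πi m₂ (ξ₂ − kξ₁)/ξ₁} · e^{πi m₁ sgn(ξ₁) ξ₁²} for ξ₁ ≠ 0. Then the family {Φ̂_{0,k,m} : k ∈ ℤ, m ∈ ℤ²} is an orthonormal system in L²(ℝ²). -/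
open Complex MeasureTheory

/-- The trapezoidal frequency region `K = {ξ : |ξ₁| ≤ 1, |ξ₂/ξ₁| ≤ 1/2}`. -/
def Kset : Set (ℝ × ℝ) := {ξ | |ξ.1| ≤ 1 ∧ |ξ.2 / ξ.1| ≤ 1 / 2}

/-- The group-based Shannon shearlet scaling system (frequency side), built from
sheared chirp modulations of the indicator of `K`:
`Φ̂_{0,k,m}(ξ) = χ_K(ξ₁, ξ₂ − kξ₁) e^{2πi m₂ (ξ₂−kξ₁)/ξ₁} e^{πi m₁ sgn(ξ₁) ξ₁²}`. -/
noncomputable def PhiHatShannon (k : ℤ) (m : ℤ × ℤ) (ξ : ℝ × ℝ) : ℂ :=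
  Set.indicator Kset (fun _ => (1 : ℂ)) (ξ.1, ξ.2 - (k : ℝ) * ξ.1) *
    Complex.exp (2 * Real.pi * Complex.I * (m.2 : ℝ) * ((ξ.2 - (k : ℝ) * ξ.1) / ξ.1)) *
    Complex.exp (Real.pi * Complex.I * (m.1 : ℝ) * Real.sign ξ.1 * ξ.1 ^ 2)

/-- The radial factor of the scaling system. -/
noncomputable def chirpFactor (n : ℤ) (x : ℝ) : ℂ :=
  (Set.Icc (-1 : ℝ) 1).indicator (fun _ => (1 : ℂ)) x *
    Complex.exp (Real.pi * Complex.I * (n : ℝ) * Real.sign x * x ^ 2)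

/-- The slope factor of the scaling system. -/
noncomputable def slopeFactor (k n : ℤ) (t : ℝ) : ℂ :=
  (Set.Icc (k - 1 / 2 : ℝ) (k + 1 / 2)).indicator (fun _ => (1 : ℂ)) t *
    Complex.exp (2 * Real.pi * Complex.I * (n : ℝ) * (t - k))

lemma PhiHatShannon_eq_chirpFactor_mul_slopeFactor (k : ℤ) (m : ℤ × ℤ) {ξ : ℝ × ℝ}
    (hξ : ξ.1 ≠ 0) :
    PhiHatShannon k m ξ = chirpFactor m.1 ξ.1 * slopeFactor k m.2 (ξ.2 / ξ.1) := by
  have hdiv : (ξ.2 - k * ξ.1) / ξ.1 = ξ.2 / ξ.1 - k := by field_simp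
  have hdivC : ((ξ.2 : ℂ) - (k : ℝ) * ξ.1) / ξ.1 = (ξ.2 / ξ.1 : ℝ) - k := by
    rw [← Complex.ofReal_intCast, ← Complex.ofReal_sub, ← hdiv]
    push_cast
    rfl
  have hmem : (ξ.1, ξ.2 - (k : ℝ) * ξ.1) ∈ Kset ↔
      ξ.1 ∈ Set.Icc (-1 : ℝ) 1 ∧ ξ.2 / ξ.1 ∈ Set.Icc (k - 1 / 2 : ℝ) (k + 1 / 2) := by
    simp only [Kset, Set.mem_ofPred_eq, hdiv, abs_le, Set.mem_Icc]
    constructor <;> rintro ⟨h, h₁, h₂⟩ <;> exact ⟨h, by linarith, by linarith⟩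
  unfold PhiHatShannon chirpFactor slopeFactor
  rw [hdivC]
  by_cases h₁ : ξ.1 ∈ Set.Icc (-1 : ℝ) 1 <;>
    by_cases h₂ : ξ.2 / ξ.1 ∈ Set.Icc (k - 1 / 2 : ℝ) (k + 1 / 2)
  · rw [Set.indicator_of_mem (hmem.2 ⟨h₁, h₂⟩), Set.indicator_of_mem h₁,
      Set.indicator_of_mem h₂]
    ring
  all_goals
    rw [Set.indicator_of_notMem (fun h => by tauto)]
    simp [h₁, h₂, -one_div, -Set.mem_Icc]

lemma Real.measurable_sign : Measurable Real.sign :=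
  Measurable.ite measurableSet_Iio measurable_const
    (Measurable.ite measurableSet_Ioi measurable_const measurable_const)

/-- Integration in the coordinates `(x, y / x)`, whose Jacobian is `|x|`. -/
lemma integral_mul_comp_slope {a b : ℝ → ℂ} (ha : Measurable a) (hb : Measurable b)
    (ha' : Integrable fun x : ℝ => ((|x| : ℝ) : ℂ) * a x) (hb' : Integrable b) :
    ∫ ξ : ℝ × ℝ, a ξ.1 * b (ξ.2 / ξ.1) = (∫ x : ℝ, ((|x| : ℝ) : ℂ) * a x) * ∫ t, b t := by
  have hne : ∀ᵐ x : ℝ, x ≠ 0 := by simp [ae_iff]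
  have hf_int : Integrable (fun ξ : ℝ × ℝ => a ξ.1 * b (ξ.2 / ξ.1))
      (volume.prod volume) := by
    refine (integrable_prod_iff ?_).2 ⟨?_, ?_⟩
    · exact Measurable.aestronglyMeasurable (by fun_prop)
    · filter_upwards [hne] with x hx
      exact (hb'.comp_div hx).const_mul (a x)
    · refine (ha'.norm.mul_const (∫ t, ‖b t‖)).congr ?_
      refine Filter.Eventually.of_forall fun x => ?_
      simp only [norm_mul, integral_const_mul]
      rw [Measure.integral_comp_div (fun t => ‖b t‖) x]
      simp
      ring
  rw [Measure.volume_eq_prod, integral_prod _ hf_int, ← integral_mul_const]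
  refine integral_congr_ae (Filter.Eventually.of_forall fun x => ?_)
  simp only [integral_const_mul]
  rw [Measure.integral_comp_div b x]
  simp
  ring

lemma chirpFactor_mul_conj (n n' : ℤ) (x : ℝ) :
    chirpFactor n x * (starRingEnd ℂ) (chirpFactor n' x) = chirpFactor (n - n') x := by
  unfold chirpFactor
  by_cases h : x ∈ Set.Icc (-1 : ℝ) 1
  · simp only [h, Set.indicator_of_mem, one_mul, ← Complex.exp_conj, ← Complex.exp_add]
    congr 1
    simp
    ring
  · simp [h]

lemma slopeFactor_mul_conj (k n n' : ℤ) (t : ℝ) :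
    slopeFactor k n t * (starRingEnd ℂ) (slopeFactor k n' t) = slopeFactor k (n - n') t := by
  unfold slopeFactor
  by_cases h : t ∈ Set.Icc (k - 1 / 2 : ℝ) (k + 1 / 2)
  · simp only [h, Set.indicator_of_mem, one_mul, ← Complex.exp_conj, ← Complex.exp_add]
    congr 1
    simp [Complex.conj_ofNat]
    ring
  · simp [h, -one_div, -Set.mem_Icc]

lemma measurable_chirpFactor (n : ℤ) : Measurable (chirpFactor n) := by
  have := Real.measurable_sign
  unfold chirpFactor
  exact (measurable_const.indicator measurableSet_Icc).mul (by fun_prop)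

lemma measurable_slopeFactor (k n : ℤ) : Measurable (slopeFactor k n) := by
  unfold slopeFactor
  exact (measurable_const.indicator measurableSet_Icc).mul (by fun_prop)

lemma norm_chirpFactor (n : ℤ) (x : ℝ) :
    ‖chirpFactor n x‖ = (Set.Icc (-1 : ℝ) 1).indicator (fun _ => (1 : ℝ)) x := by
  unfold chirpFactor
  by_cases h : x ∈ Set.Icc (-1 : ℝ) 1 <;> simp [h, Complex.norm_exp, ← Complex.ofReal_pow]

lemma norm_slopeFactor (k n : ℤ) (t : ℝ) :
    ‖slopeFactor k n t‖ =
      (Set.Icc (k - 1 / 2 : ℝ) (k + 1 / 2)).indicator (fun _ => (1 : ℝ)) t := by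
  unfold slopeFactor
  by_cases h : t ∈ Set.Icc (k - 1 / 2 : ℝ) (k + 1 / 2) <;>
    simp [h, -one_div, -Set.mem_Icc, Complex.norm_exp]

lemma integrable_abs_mul_chirpFactor (n : ℤ) :
    Integrable fun x : ℝ => ((|x| : ℝ) : ℂ) * chirpFactor n x := by
  have hg : Integrable ((Set.Icc (-1 : ℝ) 1).indicator fun _ => (1 : ℝ)) :=
    (integrable_indicator_iff measurableSet_Icc).2 (integrableOn_const (by simp))
  have := measurable_chirpFactor n
  refine hg.mono' (Measurable.aestronglyMeasurable (by fun_prop))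
    (Filter.Eventually.of_forall fun x => ?_)
  rw [norm_mul, norm_chirpFactor]
  by_cases h : x ∈ Set.Icc (-1 : ℝ) 1
  · simpa [h] using abs_le.2 h
  · simp [h]

lemma integrable_slopeFactor (k n : ℤ) : Integrable (slopeFactor k n) := by
  have hg : Integrable ((Set.Icc (k - 1 / 2 : ℝ) (k + 1 / 2)).indicator fun _ => (1 : ℝ)) :=
    (integrable_indicator_iff measurableSet_Icc).2 (integrableOn_const (by simp))
  exact hg.mono' (measurable_slopeFactor k n).aestronglyMeasurable
    (Filter.Eventually.of_forall fun t => (norm_slopeFactor k n t).le)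

lemma integral_slopeFactor (k n : ℤ) :
    ∫ t, slopeFactor k n t = if n = 0 then 1 else 0 := by
  have hI : slopeFactor k n = (Set.Icc (k - 1 / 2 : ℝ) (k + 1 / 2)).indicator
      fun t : ℝ => Complex.exp (2 * Real.pi * Complex.I * n * ((t - k : ℝ) : ℂ)) := by
    ext t
    unfold slopeFactor
    by_cases h : t ∈ Set.Icc (k - 1 / 2 : ℝ) (k + 1 / 2) <;> simp [h, -one_div, -Set.mem_Icc]
  rw [hI, integral_indicator measurableSet_Icc, integral_Icc_eq_integral_Ioc,
    ← intervalIntegral.integral_of_le (by linarith),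
    intervalIntegral.integral_comp_sub_right
      (fun t : ℝ => Complex.exp (2 * Real.pi * Complex.I * n * (t : ℂ)))]
  split_ifs with hn
  · simp [hn]
    norm_num
  · have hc : (2 * Real.pi * Complex.I * n : ℂ) ≠ 0 := by
      simp [Real.pi_ne_zero, hn]
    rw [integral_exp_mul_complex hc, div_eq_zero_iff]
    left
    rw [sub_eq_zero, Complex.exp_eq_exp_iff_exists_int]
    exact ⟨n, by push_cast; ring⟩

lemma integral_abs_mul_chirpFactor (n : ℤ) :
    ∫ x : ℝ, ((|x| : ℝ) : ℂ) * chirpFactor n x = if n = 0 then 1 else 0 := by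
  have hI : (fun x : ℝ => ((|x| : ℝ) : ℂ) * chirpFactor n x) = (Set.Icc (-1 : ℝ) 1).indicator
      fun x : ℝ => ((|x| : ℝ) : ℂ) * Complex.exp (Real.pi * Complex.I * n * Real.sign x * x ^ 2) := by
    ext x
    unfold chirpFactor
    by_cases h : x ∈ Set.Icc (-1 : ℝ) 1 <;> simp [h]
  have hf_int := integrable_abs_mul_chirpFactor n
  rw [hI, integrable_indicator_iff measurableSet_Icc] at hf_int
  have hii : ∀ {u v : ℝ}, -1 ≤ u → u ≤ v → v ≤ 1 → IntervalIntegrable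
      (fun x : ℝ => ((|x| : ℝ) : ℂ) * Complex.exp (Real.pi * Complex.I * n * Real.sign x * x ^ 2))
      volume u v := fun hu huv hv =>
    (intervalIntegrable_iff_integrableOn_Icc_of_le huv).2
      (hf_int.mono_set (Set.Icc_subset_Icc hu hv))
  have hpos : ∫ x in (0 : ℝ)..1,
      ((|x| : ℝ) : ℂ) * Complex.exp (Real.pi * Complex.I * n * Real.sign x * x ^ 2) =
      ∫ x in (0 : ℝ)..1, (x : ℂ) * Complex.exp (Real.pi * Complex.I * n * x ^ 2) := by
    refine intervalIntegral.integral_congr_ae (Filter.Eventually.of_forall fun x hx => ?_)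
    rw [Set.uIoc_of_le zero_le_one] at hx
    simp [abs_of_pos hx.1, Real.sign_of_pos hx.1]
  have hneg : ∫ x in (-1 : ℝ)..0,
      ((|x| : ℝ) : ℂ) * Complex.exp (Real.pi * Complex.I * n * Real.sign x * x ^ 2) =
      ∫ x in (0 : ℝ)..1, (x : ℂ) * Complex.exp (-(Real.pi * Complex.I * n * x ^ 2)) := by
    rw [← neg_zero, ← intervalIntegral.integral_comp_neg, neg_zero]
    refine intervalIntegral.integral_congr_ae (Filter.Eventually.of_forall fun x hx => ?_)
    rw [Set.uIoc_of_le zero_le_one] at hx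
    simp [abs_of_pos hx.1, Real.sign_of_pos hx.1, Real.sign_neg]
  rw [hI, integral_indicator measurableSet_Icc, integral_Icc_eq_integral_Ioc,
    ← intervalIntegral.integral_of_le (by norm_num),
    ← intervalIntegral.integral_add_adjacent_intervals
      (hii le_rfl (by norm_num) zero_le_one) (hii (by norm_num) zero_le_one le_rfl),
    hpos, hneg, ← intervalIntegral.integral_add
      (Continuous.intervalIntegrable (by fun_prop) _ _)
      (Continuous.intervalIntegrable (by fun_prop) _ _)]
  split_ifs with hn
  · have h2 : ∫ x in (0 : ℝ)..1, (x : ℂ) = 1 / 2 := by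
      rw [intervalIntegral.integral_ofReal]
      simp
    subst hn
    simp only [Int.cast_zero, mul_zero, zero_mul, neg_zero, Complex.exp_zero, mul_one]
    rw [intervalIntegral.integral_add (Continuous.intervalIntegrable (by fun_prop) _ _)
      (Continuous.intervalIntegrable (by fun_prop) _ _), h2]
    norm_num
  · have hc : (Real.pi * Complex.I * n : ℂ) ≠ 0 := by
      simp [Real.pi_ne_zero, hn]
    set c : ℂ := Real.pi * Complex.I * n with hc_def
    have hderiv : ∀ x ∈ Set.uIcc (0 : ℝ) 1, HasDerivAt
        (fun x : ℝ => (Complex.exp (c * (x : ℂ) ^ 2) - Complex.exp (-(c * (x : ℂ) ^ 2))) / (2 * c))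
        ((x : ℂ) * Complex.exp (-(c * (x : ℂ) ^ 2)) + x * Complex.exp (c * (x : ℂ) ^ 2)) x := by
      intro x _
      have hq : HasDerivAt (fun x : ℝ => c * (x : ℂ) ^ 2) (c * (2 * x)) x := by
        simpa using ((hasDerivAt_id x).ofReal_comp.pow 2).const_mul c
      refine ((hq.cexp.sub hq.neg.cexp).div_const (2 * c)).congr_deriv ?_
      simp only [Pi.neg_apply]
      field_simp
      ring
    rw [intervalIntegral.integral_eq_sub_of_hasDerivAt hderiv
      (Continuous.intervalIntegrable (by fun_prop) _ _)]
    have hexp : Complex.exp c = Complex.exp (-c) :=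
      Complex.exp_eq_exp_iff_exists_int.2 ⟨n, by rw [hc_def]; ring⟩
    simp [hexp]

lemma slopeFactor_mul_conj_ae_eq_zero {k k' : ℤ} (hk : k ≠ k') (n n' : ℤ) :
    (fun t => slopeFactor k n t * (starRingEnd ℂ) (slopeFactor k' n' t)) =ᵐ[volume] 0 := by
  have hne : ∀ᵐ t : ℝ, t ≠ (k + k') / 2 := by simp [ae_iff]
  filter_upwards [hne] with t ht
  unfold slopeFactor
  by_cases h : t ∈ Set.Icc (k - 1 / 2 : ℝ) (k + 1 / 2)
  · have h' : t ∉ Set.Icc (k' - 1 / 2 : ℝ) (k' + 1 / 2) := by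
      intro h'
      apply ht
      rcases lt_or_gt_of_ne hk with hlt | hlt
      · have : (k : ℝ) + 1 ≤ k' := by exact_mod_cast hlt
        linarith [h.1, h.2, h'.1, h'.2]
      · have : (k' : ℝ) + 1 ≤ k := by exact_mod_cast hlt
        linarith [h.1, h.2, h'.1, h'.2]
    simp [h', -one_div, -Set.mem_Icc]
  · simp [h, -one_div, -Set.mem_Icc]

lemma integrable_slopeFactor_mul_conj (k k' n n' : ℤ) :
    Integrable fun t => slopeFactor k n t * (starRingEnd ℂ) (slopeFactor k' n' t) := by
  by_cases hk : k = k'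
  · subst hk
    simpa only [slopeFactor_mul_conj] using integrable_slopeFactor k (n - n')
  · exact (integrable_zero ℝ ℂ volume).congr (slopeFactor_mul_conj_ae_eq_zero hk n n').symm

lemma integral_slopeFactor_mul_conj (k k' n n' : ℤ) :
    ∫ t, slopeFactor k n t * (starRingEnd ℂ) (slopeFactor k' n' t) =
      if k = k' ∧ n = n' then 1 else 0 := by
  by_cases hk : k = k'
  · subst hk
    simp only [slopeFactor_mul_conj, integral_slopeFactor, sub_eq_zero, true_and]
  · rw [integral_congr_ae (slopeFactor_mul_conj_ae_eq_zero hk n n')]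
    simp [hk]

/-- The family `{Φ̂_{0,k,m} : k ∈ ℤ, m ∈ ℤ²}` is an orthonormal
system in `L²(ℝ²)`. -/
theorem shannon_shearlet_orthonormal :
    ∀ (k k' : ℤ) (m m' : ℤ × ℤ),
      (∫ ξ : ℝ × ℝ, PhiHatShannon k m ξ * (starRingEnd ℂ) (PhiHatShannon k' m' ξ)) =
        if k = k' ∧ m = m' then 1 else 0 := by
  intro k k' m m'
  have hne : ∀ᵐ ξ : ℝ × ℝ, ξ.1 ≠ 0 :=
    Measure.quasiMeasurePreserving_fst.ae (by simp [ae_iff] : ∀ᵐ x : ℝ, x ≠ 0)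
  have hae : (fun ξ : ℝ × ℝ => PhiHatShannon k m ξ * (starRingEnd ℂ) (PhiHatShannon k' m' ξ))
      =ᵐ[volume] fun ξ => chirpFactor (m.1 - m'.1) ξ.1 *
        (fun t => slopeFactor k m.2 t * (starRingEnd ℂ) (slopeFactor k' m'.2 t))
          (ξ.2 / ξ.1) := by
    filter_upwards [hne] with ξ hξ
    rw [PhiHatShannon_eq_chirpFactor_mul_slopeFactor k m hξ,
      PhiHatShannon_eq_chirpFactor_mul_slopeFactor k' m' hξ, ← chirpFactor_mul_conj, map_mul]
    ring
  have hmeas : Measurable fun t =>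
      slopeFactor k m.2 t * (starRingEnd ℂ) (slopeFactor k' m'.2 t) :=
    (measurable_slopeFactor k m.2).mul
      (Complex.continuous_conj.measurable.comp (measurable_slopeFactor k' m'.2))
  rw [integral_congr_ae hae, integral_mul_comp_slope (measurable_chirpFactor _) hmeas
    (integrable_abs_mul_chirpFactor _) (integrable_slopeFactor_mul_conj ..),
    integral_abs_mul_chirpFactor, integral_slopeFactor_mul_conj]
  simp only [sub_eq_zero, Prod.ext_iff]
  split_ifs <;> simp_all
end
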